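/- Let G=(V,w) be a weighted graph, o a vertex and z a set of vertices with dist(o,z) ≥ n+1 for an integer n ≥ 0, let g > 1 be a solution of (g−1)² g^{n−2} = 2 w_z/w_o, and let 1 < a < (g+1)/(g−1). Then P(T_{oz} ≤ an+1) ≤ e^{−I_g(a) n}, where e^{−I_g(a)} = (g/(a+1)) · (g/(a²−1))^{(a−1)/2} · (2a/(g+1))^a. -/

import Mathlib

open MeasureTheory Filter
open scoped Classical ENNReal

namespace RWHitting

/-- A weighted graph on a vertex set `V`: a symmetric weight function with
positive finite vertex weights. -/
structure WeightedGraph (V : Type*) where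
  w : V → V → ℝ≥0∞
  symm : ∀ x y, w x y = w y x
  vw_pos : ∀ x, 0 < ∑' y, w x y
  vw_lt_top : ∀ x, ∑' y, w x y < ⊤

namespace WeightedGraph

variable {V : Type*}

/-- The weight of a vertex. -/
noncomputable def vw (G : WeightedGraph V) (x : V) : ℝ≥0∞ := ∑' y, G.w x y

/-- The weight of a vertex set. -/
noncomputable def setWeight (G : WeightedGraph V) (z : Set V) : ℝ≥0∞ := ∑' x : z, G.vw x

/-- `G.distGE o z m` : every path of positive-weight steps from `o` into `z` has length `≥ m`. -/
def distGE (G : WeightedGraph V) (o : V) (z : Set V) (m : ℕ) : Prop :=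
  ∀ (k : ℕ) (p : ℕ → V), p 0 = o → (∀ i, i < k → 0 < G.w (p i) (p (i+1))) → p k ∈ z → m ≤ k

/-- Transition probabilities of the random walk on `G`. -/
noncomputable def trans (G : WeightedGraph V) (x y : V) : ℝ≥0∞ := G.w x y / G.vw x

/-- Graph distance (as an extended nonneg real). -/
noncomputable def edist (G : WeightedGraph V) (x y : V) : ℝ≥0∞ :=
  ⨅ (k : ℕ) (_ : ∃ p : ℕ → V, p 0 = x ∧ p k = y ∧ ∀ i, i < k → 0 < G.w (p i) (p (i+1))),
    (k : ℝ≥0∞)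

/-- Total weight of the edges at distance `n` from `o` (each non-loop edge counted in both
orientations). -/
noncomputable def boundaryWeight (G : WeightedGraph V) (o : V) (n : ℕ) : ℝ≥0∞ :=
  ∑' q : V × V, if min (G.edist o q.1) (G.edist o q.2) = (n : ℝ≥0∞) then G.w q.1 q.2 else 0

end WeightedGraph

variable {V : Type*}

/-- `μ` is the law of the random walk on `G` started at `o`. -/
def IsRandomWalk [MeasurableSpace V] (G : WeightedGraph V) (o : V)
    (μ : Measure (ℕ → V)) : Prop :=
  IsProbabilityMeasure μ ∧
  ∀ (k : ℕ) (x : Fin (k+1) → V),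
    μ {ω | ∀ i : Fin (k+1), ω (i : ℕ) = x i}
      = (if x 0 = o then 1 else 0) * ∏ i : Fin k, G.trans (x i.castSucc) (x i.succ)

/-- First hitting time of the set `z` (`∞` if `z` is never visited). -/
noncomputable def hitTime (z : Set V) (ω : ℕ → V) : ℝ≥0∞ :=
  ⨅ (k : ℕ) (_ : ω k ∈ z), (k : ℝ≥0∞)

/-- Expected hitting time of `z`. -/
noncomputable def expHit [MeasurableSpace V] (μ : Measure (ℕ → V)) (z : Set V) : ℝ≥0∞ :=
  ∫⁻ ω, hitTime z ω ∂μ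

/-- Number of visits to `o` (counting time 0) strictly before hitting `z`. -/
noncomputable def visitsBefore (z : Set V) (o : V) (ω : ℕ → V) : ℝ≥0∞ :=
  ∑' k : ℕ, if ω k = o ∧ (k : ℝ≥0∞) < hitTime z ω then 1 else 0

/-- Effective resistance between `o` and `z`, defined probabilistically via the random walk
law `μ`:  `w_o r_{oz}` is the expected number of visits to `o` before hitting `z`. -/
noncomputable def resistance [MeasurableSpace V] (G : WeightedGraph V) (o : V) (z : Set V)
    (μ : Measure (ℕ → V)) : ℝ≥0∞ :=
  (∫⁻ ω, visitsBefore z o ω ∂μ) / G.vw o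

/-- One-step transition probabilities for the biased simple random walk on `ℤ`
with odds `1 : g` of going left/right. -/
noncomputable def biasedStep (g : ℝ) (a b : ℤ) : ℝ≥0∞ :=
  if b = a + 1 then ENNReal.ofReal (g / (g+1))
  else if b = a - 1 then ENNReal.ofReal (1 / (g+1)) else 0

/-- `ν` is the law of the biased simple random walk on `ℤ` started at `0`,
stepping right with probability `g/(g+1)` and left with probability `1/(g+1)`. -/
def IsBiasedWalk (g : ℝ) (ν : Measure (ℕ → ℤ)) : Prop :=
  IsProbabilityMeasure ν ∧
  ∀ (k : ℕ) (x : Fin (k+1) → ℤ),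
    ν {ω | ∀ i : Fin (k+1), ω (i : ℕ) = x i}
      = (if x 0 = 0 then 1 else 0) * ∏ i : Fin k, biasedStep g (x i.castSucc) (x i.succ)

/-- `e^{-λ t}` for an extended-real time `t`, with the convention `e^{-λ ∞} = 0`. -/
noncomputable def expNeg (lam : ℝ) (t : ℝ≥0∞) : ℝ≥0∞ :=
  if t = ⊤ then 0 else ENNReal.ofReal (Real.exp (-lam * t.toReal))

open Topology

/-- `biasedDiscount g r` is the `s` at which the hitting time of a neighbour by the biased walk has
generating function `r`. -/
noncomputable def biasedDiscount (g r : ℝ) : ℝ := r * (1 + g) / (g + r ^ 2)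

theorem biasedDiscount_pos {g r : ℝ} (hg : 1 < g) (hr : 0 < r) : 0 < biasedDiscount g r := by
  unfold biasedDiscount; positivity

theorem biasedDiscount_lt_one {g r : ℝ} (hg : 1 < g) (hr : 0 < r) (hr1 : r < 1) :
    biasedDiscount g r < 1 := by
  unfold biasedDiscount
  rw [div_lt_one (by positivity)]
  nlinarith [mul_pos (sub_pos.2 hr1) (sub_pos.2 (hr1.trans hg))]

theorem hasDerivAt_biasedDiscount {g r : ℝ} (hg : 1 < g) (hr : 0 < r) :
    HasDerivAt (biasedDiscount g)
      (biasedDiscount g r * ((g - r ^ 2) / (r * (g + r ^ 2)))) r := by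
  have h1 : HasDerivAt (fun r : ℝ => r * (1 + g)) (1 + g) r := by
    simpa using (hasDerivAt_id r).mul_const (1 + g)
  have h2 : HasDerivAt (fun r : ℝ => g + r ^ 2) (2 * r) r := by
    simpa using (hasDerivAt_pow 2 r).const_add g
  have h0 : g + r ^ 2 ≠ 0 := by positivity
  refine (h1.div h2 h0).congr_deriv ?_
  unfold biasedDiscount
  field_simp
  ring

/-- A finite symmetric network in which the walk at `x` moves to `y` with probability
`c x y / m x`, is absorbed in the target with probability `q x / m x`, and is killed otherwise. -/
structure KilledNetwork (D : Type*) [Fintype D] where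
  c : D → D → ℝ
  q : D → ℝ
  m : D → ℝ
  c_symm : ∀ x y, c x y = c y x
  c_nonneg : ∀ x y, 0 ≤ c x y
  q_nonneg : ∀ x, 0 ≤ q x
  m_pos : ∀ x, 0 < m x
  sum_le : ∀ x, ∑ y, c x y + q x ≤ m x

namespace KilledNetwork

variable {D : Type*} [Fintype D] (N : KilledNetwork D)

/-- `v` solves the discounted Poisson equation with source `b`. -/
def IsPotential (s : ℝ) (b v : D → ℝ) : Prop :=
  ∀ x, N.m x * v x = s * ∑ y, N.c x y * v y + b x

variable {N} {s t : ℝ} {b b' v v' : D → ℝ}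

theorem IsPotential.nonneg (hs : 0 < s) (hs1 : s < 1) (h : N.IsPotential s b v)
    (hb : ∀ x, 0 ≤ b x) (x : D) : 0 ≤ v x := by
  have : Nonempty D := ⟨x⟩
  obtain ⟨x₀, hx₀⟩ := Finite.exists_min v
  refine le_trans ?_ (hx₀ x)
  by_contra! hneg
  have h1 : ∑ y, N.c x₀ y * v x₀ ≤ ∑ y, N.c x₀ y * v y :=
    Finset.sum_le_sum fun y _ => mul_le_mul_of_nonneg_left (hx₀ y) (N.c_nonneg _ _)
  rw [← Finset.sum_mul] at h1
  have h2 : N.m x₀ * v x₀ ≤ (∑ y, N.c x₀ y) * v x₀ :=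
    mul_le_mul_of_nonpos_right (by linarith [N.sum_le x₀, N.q_nonneg x₀]) hneg.le
  have h3 := h x₀
  have h4 : s * (N.m x₀ * v x₀) ≤ s * ∑ y, N.c x₀ y * v y :=
    mul_le_mul_of_nonneg_left (h2.trans h1) hs.le
  have h5 : N.m x₀ * v x₀ < 0 := mul_neg_of_pos_of_neg (N.m_pos _) hneg
  nlinarith [hb x₀]

variable (N) in
theorem exists_isPotential (hs : 0 < s) (hs1 : s < 1) (b : D → ℝ) :
    ∃ v, N.IsPotential s b v := by
  set M : Matrix D D ℝ := Matrix.diagonal N.m - s • Matrix.of N.c with hM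
  have hmul : ∀ v x, M.mulVec v x = N.m x * v x - s * ∑ y, N.c x y * v y := fun v x => by
    rw [hM, Matrix.sub_mulVec, Matrix.smul_mulVec, Pi.sub_apply, Matrix.mulVec_diagonal]
    simp [Matrix.mulVec, dotProduct]
  have hdet : M.det ≠ 0 := by
    intro h0
    obtain ⟨v, hv, hv0⟩ := Matrix.exists_mulVec_eq_zero_iff.2 h0
    have key : N.IsPotential s 0 v := fun x => by
      have := congrFun hv0 x
      rw [hmul, Pi.zero_apply] at this
      rw [Pi.zero_apply]
      linarith
    have key' : N.IsPotential s 0 (-v) := fun x => by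
      have := key x
      simp only [Pi.neg_apply, mul_neg, Finset.sum_neg_distrib, Pi.zero_apply] at this ⊢
      linarith
    refine hv (funext fun x => le_antisymm ?_ (key.nonneg hs hs1 (fun _ => le_rfl) x))
    simpa using key'.nonneg hs hs1 (fun _ => le_rfl) x
  refine ⟨M⁻¹.mulVec b, fun x => ?_⟩
  have : M.mulVec (M⁻¹.mulVec b) = b := by
    rw [Matrix.mulVec_mulVec, Matrix.mul_nonsing_inv _ (isUnit_iff_ne_zero.2 hdet),
      Matrix.one_mulVec]
  have := congrFun this x
  rw [hmul] at this
  linarith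

theorem IsPotential.reciprocity (h : N.IsPotential s b v) (h' : N.IsPotential s b' v') :
    ∑ x, b x * v' x = ∑ x, b' x * v x := by
  have e1 : ∀ x, b x * v' x = N.m x * v x * v' x - s * ∑ y, N.c x y * v y * v' x := fun x => by
    rw [← Finset.sum_mul]; linear_combination -(v' x) * h x
  have e2 : ∀ x, b' x * v x = N.m x * v x * v' x - s * ∑ y, N.c x y * v' y * v x := fun x => by
    rw [← Finset.sum_mul]; linear_combination -(v x) * h' x
  simp only [e1, e2, Finset.sum_sub_distrib, ← Finset.mul_sum]
  rw [Finset.sum_comm]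
  simp only [N.c_symm, mul_right_comm]

theorem IsPotential.le_discount (hs : 0 < s) (hs1 : s < 1)
    (h : N.IsPotential s (fun x => s * N.q x) v) (x : D) : v x ≤ s := by
  have h1 : ∀ x, v x ≤ 1 := fun x => by
    have : N.IsPotential s (fun x => N.m x - s * (∑ y, N.c x y + N.q x)) (fun x => 1 - v x) :=
      fun x => by
        have := h x
        simp only [mul_sub, mul_one, Finset.sum_sub_distrib]
        linarith
    refine sub_nonneg.1 (this.nonneg hs hs1 (fun x => ?_) x)
    nlinarith [N.sum_le x, N.m_pos x]
  have h2 : ∑ y, N.c x y * v y ≤ ∑ y, N.c x y :=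
    Finset.sum_le_sum fun y _ => mul_le_of_le_one_right (N.c_nonneg _ _) (h1 y)
  have h3 : N.m x * v x ≤ N.m x * s := by
    rw [h x]
    nlinarith [N.sum_le x]
  exact le_of_mul_le_mul_left h3 (N.m_pos x)

variable (N) in
/-- The generating function at `s` of the absorption time, as a function of the starting point
(and `0` outside `0 < s < 1`). -/
noncomputable def hitGen (s : ℝ) : D → ℝ :=
  if h : 0 < s ∧ s < 1 then (N.exists_isPotential h.1 h.2 fun x => s * N.q x).choose else 0

variable (N) in
theorem hitGen_isPotential (hs : 0 < s) (hs1 : s < 1) :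
    N.IsPotential s (fun x => s * N.q x) (N.hitGen s) := by
  rw [hitGen, dif_pos ⟨hs, hs1⟩]
  exact (N.exists_isPotential hs hs1 fun x => s * N.q x).choose_spec

variable (N) in
theorem hitGen_nonneg (hs : 0 < s) (hs1 : s < 1) (x : D) : 0 ≤ N.hitGen s x :=
  (N.hitGen_isPotential hs hs1).nonneg hs hs1 (fun x => mul_nonneg hs.le (N.q_nonneg x)) x

variable (N) in
theorem hitGen_le (hs : 0 < s) (hs1 : s < 1) (x : D) : N.hitGen s x ≤ s :=
  (N.hitGen_isPotential hs hs1).le_discount hs hs1 x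

/-- Resolvent identity for the hitting time generating function. -/
theorem hitGen_sub {u : D → ℝ} {o : D} (hs : 0 < s) (hs1 : s < 1) (ht : 0 < t) (ht1 : t < 1)
    (hu : N.IsPotential s (Pi.single o 1) u) :
    N.hitGen t o - N.hitGen s o = (t - s) * ∑ x, N.m x * u x * (N.hitGen t x / t) := by
  have hd : N.IsPotential s (fun x => (t - s) * (N.m x * (N.hitGen t x / t)))
      (fun x => N.hitGen t x - N.hitGen s x) := fun x => by
    have h1 := N.hitGen_isPotential hs hs1 x
    have h2 := N.hitGen_isPotential ht ht1 x
    have h3 : N.m x * (N.hitGen t x / t) = ∑ y, N.c x y * N.hitGen t y + N.q x := by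
      field_simp
      linarith
    simp only [mul_sub, Finset.sum_sub_distrib]
    rw [h3]
    linarith
  have := hu.reciprocity hd
  simp only [Pi.single_apply, ite_mul, one_mul, zero_mul, Finset.sum_ite_eq', Finset.mem_univ,
    if_true] at this
  rw [this, Finset.mul_sum]
  exact Finset.sum_congr rfl fun x _ => by ring

variable (N) in
theorem continuousAt_hitGen (hs : 0 < s) (hs1 : s < 1) (o : D) :
    ContinuousAt (fun t => N.hitGen t o) s := by
  obtain ⟨u, hu⟩ := N.exists_isPotential hs hs1 (Pi.single o 1)
  rw [ContinuousAt, tendsto_iff_norm_sub_tendsto_zero]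
  have hlim : Tendsto (fun t : ℝ => |t - s| * ∑ x, |N.m x * u x|) (𝓝 s) (𝓝 0) := by
    have : Continuous fun t : ℝ => |t - s| * ∑ x, |N.m x * u x| := by fun_prop
    simpa using this.tendsto s
  refine squeeze_zero' (Eventually.of_forall fun _ => norm_nonneg _) ?_ hlim
  filter_upwards [Ioo_mem_nhds hs hs1] with t ht
  rw [hitGen_sub hs hs1 ht.1 ht.2 hu, Real.norm_eq_abs, abs_mul]
  refine mul_le_mul_of_nonneg_left ((Finset.abs_sum_le_sum_abs _ _).trans
    (Finset.sum_le_sum fun x _ => ?_)) (abs_nonneg _)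
  rw [abs_mul]
  refine mul_le_of_le_one_right (abs_nonneg _) ?_
  rw [abs_of_nonneg (div_nonneg (N.hitGen_nonneg ht.1 ht.2 x) ht.1.le)]
  exact div_le_one_of_le₀ (N.hitGen_le ht.1 ht.2 x) ht.1.le

theorem hasDerivAt_hitGen {u : D → ℝ} {o : D} (hs : 0 < s) (hs1 : s < 1)
    (hu : N.IsPotential s (Pi.single o 1) u) :
    HasDerivAt (fun t => N.hitGen t o) (∑ x, N.m x * u x * (N.hitGen s x / s)) s := by
  rw [hasDerivAt_iff_tendsto_slope]
  have hc : ContinuousAt (fun t => ∑ x, N.m x * u x * (N.hitGen t x / t)) s := by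
    refine tendsto_finsetSum _ fun x _ => ?_
    exact tendsto_const_nhds.mul ((N.continuousAt_hitGen hs hs1 x).div continuousAt_id hs.ne')
  refine (hc.tendsto.mono_left nhdsWithin_le_nhds).congr' ?_
  filter_upwards [self_mem_nhdsWithin, nhdsWithin_le_nhds (Ioo_mem_nhds hs hs1)] with t hne ht
  have : t - s ≠ 0 := sub_ne_zero.2 hne
  rw [slope_def_field, hitGen_sub hs hs1 ht.1 ht.2 hu]
  field_simp

/-- Tangent line inequality for the convex function `t ↦ 1 / (e ^ t - 1)` at `t = log γ`, in
homogeneous form. -/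
theorem flow_tangent {γ a d : ℝ} (hγ : 1 < γ) (ha : 0 < a) (hd : 0 < d) :
    (a - d) / (γ - 1) - γ / (γ - 1) ^ 2 * ((a - d) * (Real.log a - Real.log d - Real.log γ))
      ≤ d := by
  have h1 : 0 < γ - 1 := sub_pos.2 hγ
  rcases le_total a d with h | h
  · have e1 : (a - d) / (γ - 1) ≤ 0 := div_nonpos_of_nonpos_of_nonneg (by linarith) h1.le
    have e2 : Real.log a ≤ Real.log d := Real.log_le_log ha h
    have e3 : 0 < Real.log γ := Real.log_pos hγ
    have e4 : 0 ≤ (a - d) * (Real.log a - Real.log d - Real.log γ) :=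
      mul_nonneg_of_nonpos_of_nonpos (by linarith) (by linarith)
    have e5 : 0 ≤ γ / (γ - 1) ^ 2 := by positivity
    linarith [mul_nonneg e5 e4]
  · have e1 : 1 - d * γ / a ≤ Real.log a - Real.log d - Real.log γ := by
      have := Real.one_sub_inv_le_log_of_pos (x := a / (d * γ)) (by positivity)
      rw [inv_div, Real.log_div ha.ne' (by positivity), Real.log_mul hd.ne' (by positivity)] at this
      linarith
    have e2 : γ / (γ - 1) ^ 2 * ((a - d) * (1 - d * γ / a))
        ≤ γ / (γ - 1) ^ 2 * ((a - d) * (Real.log a - Real.log d - Real.log γ)) :=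
      mul_le_mul_of_nonneg_left (mul_le_mul_of_nonneg_left e1 (sub_nonneg.2 h)) (by positivity)
    have e3 : d - ((a - d) / (γ - 1) - γ / (γ - 1) ^ 2 * ((a - d) * (1 - d * γ / a)))
        = (a - γ * d) ^ 2 / ((γ - 1) ^ 2 * a) := by
      field_simp
      ring
    have e4 : 0 ≤ (a - γ * d) ^ 2 / ((γ - 1) ^ 2 * a) := by positivity
    linarith

set_option maxHeartbeats 1000000 in
/-- Lower bound for the expected hitting time of the walk tilted by `f`, where `u` is the Green's
function, normalised to produce a unit flow `c x y * (u x * f y - u y * f x)`. -/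
theorem tilted_time_lower_bound {f u : D → ℝ} {o : D} {ℓ : D → ℕ} {n : ℕ} {γ X : ℝ}
    (hs : 0 < s) (hs1 : s < 1) (hn : 1 ≤ n) (hγ : 1 < γ)
    (hf : N.IsPotential s (fun x => s * N.q x) f) (hfo : 0 < f o)
    (hu : N.IsPotential s (Pi.single o (s / f o)) u)
    (hℓc : ∀ x y, 0 < N.c x y → ℓ x ≤ ℓ y + 1) (hℓo : ∀ x, ℓ x = 0 ↔ x = o)
    (hℓq : ∀ x, 0 < N.q x → ℓ x = n)
    (hX : X = (γ - 1) ^ 2 * γ ^ n / (2 * γ ^ 2))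
    (hq : s ^ 2 * ∑ x, N.q x ≤ X * (N.m o * f o ^ 2)) :
    1 + n * ((γ + 1) / (γ - 1)) ≤ ∑ x, N.m x * u x * (f x / s) := by
  have hγ1 : 0 < γ - 1 := sub_pos.2 hγ
  have hX0 : 0 < X := by rw [hX]; positivity
  have hmo := N.m_pos o
  have hf0 : ∀ x, 0 ≤ f x := hf.nonneg hs hs1 fun x => mul_nonneg hs.le (N.q_nonneg x)
  have hu0 : ∀ x, 0 ≤ u x := hu.nonneg hs hs1 fun x => by
    rw [Pi.single_apply]; split_ifs <;> positivity
  have hqo : N.q o = 0 := by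
    by_contra h
    have := hℓq o (lt_of_le_of_ne (N.q_nonneg o) (Ne.symm h))
    have := (hℓo o).2 rfl
    omega
  have hpos : ∀ v b : D → ℝ, N.IsPotential s b v → (∀ x, 0 ≤ v x) → (∀ x, 0 ≤ b x) →
      ∀ x y, 0 < N.c x y → 0 < v y → 0 < v x := by
    intro v b hv hv0 hb x y hc hy
    have h1 : N.c x y * v y ≤ ∑ y, N.c x y * v y :=
      Finset.single_le_sum (f := fun y => N.c x y * v y)
        (fun i _ => mul_nonneg (N.c_nonneg _ _) (hv0 i)) (Finset.mem_univ y)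
    have h2 : 0 < N.m x * v x := by
      rw [hv x]
      have := mul_pos hs ((mul_pos hc hy).trans_le h1)
      linarith [hb x]
    exact pos_of_mul_pos_right h2 (N.m_pos x).le
  have hfpos : ∀ x y, 0 < N.c x y → 0 < f y → 0 < f x :=
    hpos f _ hf hf0 fun x => mul_nonneg hs.le (N.q_nonneg x)
  have hupos : ∀ x y, 0 < N.c x y → 0 < u y → 0 < u x :=
    hpos u _ hu hu0 fun x => by rw [Pi.single_apply]; split_ifs <;> positivity
  have huo : 0 < u o := by
    have h := hu o
    rw [Pi.single_eq_same] at h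
    have h1 : 0 ≤ ∑ y, N.c o y * u y :=
      Finset.sum_nonneg fun y _ => mul_nonneg (N.c_nonneg _ _) (hu0 y)
    have h2 : 0 < N.m o * u o := by rw [h]; positivity
    exact pos_of_mul_pos_right h2 (N.m_pos o).le
  set a : D → D → ℝ := fun x y => N.c x y * u x * f y with ha
  set h : D → ℝ := fun x => Real.log (u x) - Real.log (f x) with hh
  have ha0 : ∀ x y, 0 ≤ a x y := fun x y =>
    mul_nonneg (mul_nonneg (N.c_nonneg _ _) (hu0 _)) (hf0 _)
  have hedge : ∀ x y, (a x y = 0 ∧ a y x = 0) ∨ (0 < N.c x y ∧ 0 < a x y ∧ 0 < a y x ∧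
      h x - h y = Real.log (a x y) - Real.log (a y x)) := by
    intro x y
    rcases (N.c_nonneg x y).eq_or_lt with hc | hc
    · left; simp [ha, N.c_symm y x, ← hc]
    have hc' : 0 < N.c y x := by rwa [N.c_symm]
    rcases (hu0 x).eq_or_lt with h1 | h1
    · have : u y = 0 := by
        by_contra h2
        exact (hupos x y hc (lt_of_le_of_ne (hu0 y) (Ne.symm h2))).ne h1
      left; simp [ha, ← h1, this]
    rcases (hf0 x).eq_or_lt with h2 | h2
    · have : f y = 0 := by
        by_contra h3
        exact (hfpos x y hc (lt_of_le_of_ne (hf0 y) (Ne.symm h3))).ne h2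
      left; simp [ha, ← h2, this]
    have h3 := hupos y x hc' h1
    have h4 := hfpos y x hc' h2
    refine Or.inr ⟨hc, by positivity, by positivity, ?_⟩
    simp only [ha, hh]
    rw [Real.log_mul (by positivity) (by positivity), Real.log_mul (by positivity) (by positivity),
      Real.log_mul (by positivity) (by positivity), Real.log_mul (by positivity) (by positivity),
      N.c_symm y x]
    ring
  -- total flow out of each vertex
  have ha_out : ∀ x, ∑ y, a x y + N.q x * u x = N.m x * u x * (f x / s) := fun x => by
    have : ∑ y, a x y = u x * ∑ y, N.c x y * f y := by
      rw [Finset.mul_sum]; exact Finset.sum_congr rfl fun y _ => by simp only [ha]; ring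
    rw [this]
    have := hf x
    field_simp
    linear_combination -(u x) * this
  have ha_in : ∀ x, ∑ y, a y x + (if x = o then 1 else 0) = N.m x * u x * (f x / s) := fun x => by
    have h1 : ∑ y, a y x = f x * ∑ y, N.c x y * u y := by
      rw [Finset.mul_sum]
      exact Finset.sum_congr rfl fun y _ => by simp only [ha]; rw [N.c_symm]; ring
    have h2 := hu x
    rw [Pi.single_apply] at h2
    rw [h1]
    by_cases hx : x = o
    · subst hx
      rw [if_pos rfl] at h2 ⊢
      field_simp at h2 ⊢
      linear_combination -h2
    · rw [if_neg hx] at h2 ⊢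
      field_simp
      linear_combination -(f x) * h2
  have hdiv : ∀ x, ∑ y, (a x y - a y x) = (if x = o then 1 else 0) - N.q x * u x := fun x => by
    rw [Finset.sum_sub_distrib]
    linarith [ha_out x, ha_in x]
  have hparts : ∀ k : D → ℝ, ∑ x, ∑ y, (a x y - a y x) * (k x - k y)
      = 2 * (k o - ∑ x, N.q x * u x * k x) := by
    intro k
    have e1 : ∑ x, ∑ y, (a x y - a y x) * k x = k o - ∑ x, N.q x * u x * k x := by
      simp only [← Finset.sum_mul, hdiv]
      simp [sub_mul]
    have e2 : ∑ x, ∑ y, (a x y - a y x) * k y = -∑ x, ∑ y, (a x y - a y x) * k x := by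
      rw [Finset.sum_comm]
      simp only [← Finset.sum_neg_distrib]
      exact Finset.sum_congr rfl fun x _ => Finset.sum_congr rfl fun y _ => by ring
    simp only [mul_sub, Finset.sum_sub_distrib, e1, e2]
    ring
  have hqu : ∑ x, N.q x * u x = 1 := by
    have := hparts fun _ => 1
    simp only [sub_self, mul_zero, Finset.sum_const_zero, mul_one] at this
    linarith
  have htotal : ∑ x, N.m x * u x * (f x / s) = 1 + ∑ x, ∑ y, a x y := by
    rw [← hqu, ← Finset.sum_add_distrib]
    exact Finset.sum_congr rfl fun x _ => by rw [← ha_out x]; ring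
  have hlevel : ∑ x, ∑ y, (a x y - a y x) * (((ℓ y - 1 : ℕ) : ℝ) - ((ℓ x - 1 : ℕ) : ℝ))
      = 2 * (n - 1) := by
    have h1 := hparts fun x => -((ℓ x - 1 : ℕ) : ℝ)
    have h2 : ∑ x, N.q x * u x * -((ℓ x - 1 : ℕ) : ℝ) = ∑ x, N.q x * u x * -((n : ℝ) - 1) := by
      refine Finset.sum_congr rfl fun x _ => ?_
      rcases (N.q_nonneg x).eq_or_lt with h | h
      · simp [← h]
      · rw [hℓq x h, Nat.cast_sub hn, Nat.cast_one]
    rw [h2, ← Finset.sum_mul, hqu, (hℓo o).2 rfl] at h1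
    simp only [sub_neg_eq_add, neg_add_eq_sub] at h1
    rw [h1]
    simp
  -- visits to the starting point
  set δ : ℝ := ∑ y, a y o with hδ
  have hout : ∑ y, a o y = 1 + δ := by
    have := ha_in o
    have := ha_out o
    rw [hqo] at this
    simp only [if_true] at *
    linarith
  have hδ0 : 0 < δ := by
    have h0 : 0 ≤ δ := Finset.sum_nonneg fun y _ => ha0 y o
    refine lt_of_le_of_ne h0 fun h1 => ?_
    have h2 : ∀ y, a y o = 0 := fun y =>
      (Finset.sum_eq_zero_iff_of_nonneg fun y _ => ha0 y o).1 h1.symm y (Finset.mem_univ y)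
    have h3 : ∑ y, a o y = 0 := Finset.sum_eq_zero fun y _ => by
      rcases hedge o y with h | h
      · exact h.1
      · exact absurd (h2 y) h.2.2.1.ne'
    linarith
  set τ : ℝ := ∑ y, (a o y - a y o) * (h o - h y) with hτ
  have hflow1 : ∑ y, (a o y - a y o) = 1 := by rw [Finset.sum_sub_distrib, hout]; ring
  have htang : ∀ γ' : ℝ, 1 < γ' → ∀ x y, (a x y - a y x) / (γ' - 1) -
      γ' / (γ' - 1) ^ 2 * ((a x y - a y x) * (h x - h y - Real.log γ')) ≤ a y x := by
    intro γ' hγ' x y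
    rcases hedge x y with h0 | ⟨-, h1, h2, h3⟩
    · simp [h0.1, h0.2]
    · rw [h3]
      exact flow_tangent hγ' h1 h2
  have hτ_lower : Real.log (1 + δ) - Real.log δ ≤ τ := by
    have hg : 1 < (1 + δ) / δ := by rw [lt_div_iff₀ hδ0]; linarith
    have := Finset.sum_le_sum fun y (_ : y ∈ Finset.univ) => htang _ hg o y
    have hτ' : ∑ y, (a o y - a y o) * (h o - h y - Real.log ((1 + δ) / δ))
        = τ - Real.log ((1 + δ) / δ) := by
      rw [Finset.sum_congr rfl fun y _ => mul_sub (a o y - a y o) (h o - h y) _,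
        Finset.sum_sub_distrib, ← Finset.sum_mul, hflow1, one_mul]
    rw [← hδ, Finset.sum_sub_distrib, ← Finset.sum_div, hflow1, ← Finset.mul_sum, hτ',
      Real.log_div (by positivity) (by positivity)] at this
    have e : (1 + δ) / δ - 1 = 1 / δ := by field_simp; ring
    rw [e, one_div_one_div] at this
    have e2 : 0 < (1 + δ) / δ / (1 / δ) ^ 2 := by positivity
    by_contra! hlt
    nlinarith
  set H : ℝ := h o - ∑ x, N.q x * u x * h x with hH
  have hH_upper : H ≤ Real.log (1 + δ) + Real.log X := by
    have hN : 1 + δ = N.m o * u o * (f o / s) := by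
      rw [← ha_out o, hout, hqo]; ring
    set B : ℝ := X * (N.m o * f o ^ 2) / s with hB
    have hB0 : 0 < B := by positivity
    have h1 : ∀ x, -(N.q x * u x * h x) ≤ N.q x * u x * (Real.log B - 1) + N.q x * f x / B := by
      intro x
      rcases (N.q_nonneg x).eq_or_lt with hqx | hqx
      · simp [← hqx]
      rcases (hu0 x).eq_or_lt with hux | hux
      · rw [← hux]
        have := mul_nonneg hqx.le (hf0 x)
        simp only [mul_zero, zero_mul, neg_zero, zero_add]
        positivity
      have hfx : 0 < f x := by
        have h1 : 0 < N.m x * f x := by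
          rw [hf x]
          have : 0 ≤ ∑ y, N.c x y * f y :=
            Finset.sum_nonneg fun y _ => mul_nonneg (N.c_nonneg _ _) (hf0 y)
          positivity
        exact pos_of_mul_pos_right h1 (N.m_pos x).le
      have hl := Real.log_le_sub_one_of_pos (x := f x / (u x * B)) (by positivity)
      rw [Real.log_div (by positivity) (by positivity), Real.log_mul (by positivity)
        (by positivity)] at hl
      have : -(N.q x * u x * h x) = N.q x * u x * (Real.log (f x) - Real.log (u x)) := by
        simp only [hh]; ring
      rw [this]
      calc _ ≤ N.q x * u x * (Real.log B - 1 + f x / (u x * B)) :=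
            mul_le_mul_of_nonneg_left (by linarith) (by positivity)
        _ = _ := by field_simp
    have h2 := Finset.sum_le_sum fun x (_ : x ∈ Finset.univ) => h1 x
    rw [Finset.sum_neg_distrib, Finset.sum_add_distrib, ← Finset.sum_mul, hqu,
      ← Finset.sum_div] at h2
    have h3 : (∑ x, N.q x * f x) / B ≤ 1 := by
      rw [div_le_one hB0, hB, le_div_iff₀ hs]
      calc (∑ x, N.q x * f x) * s ≤ (∑ x, N.q x * s) * s := by
            gcongr with x
            · exact N.q_nonneg x
            · exact hf.le_discount hs hs1 x
        _ = s ^ 2 * ∑ x, N.q x := by rw [← Finset.sum_mul]; ring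
        _ ≤ _ := hq
    have h4 : h o + Real.log B = Real.log (1 + δ) + Real.log X := by
      rw [hN, hB, hh]
      dsimp only
      rw [Real.log_div (by positivity) (by positivity), Real.log_mul (by positivity)
        (by positivity), Real.log_mul (by positivity) (by positivity), Real.log_pow,
        Real.log_mul (by positivity) (by positivity), Real.log_mul (by positivity) (by positivity),
        Real.log_div (by positivity) (by positivity)]
      push_cast
      ring
    linarith
  have hlogX : Real.log (2 * (γ / (γ - 1) ^ 2)) + Real.log X = (n - 1) * Real.log γ := by
    rw [hX, ← Real.log_mul (by positivity) (by positivity)]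
    have : 2 * (γ / (γ - 1) ^ 2) * ((γ - 1) ^ 2 * γ ^ n / (2 * γ ^ 2)) = γ ^ n / γ := by
      field_simp
    rw [this, Real.log_div (by positivity) (by positivity), Real.log_pow]
    ring
  set C : ℝ := γ / (γ - 1) ^ 2 with hC
  have hC0 : 0 < C := by positivity
  have hpair : ∀ x y, (a x y - a y x) * (((ℓ y - 1 : ℕ) : ℝ) - ((ℓ x - 1 : ℕ) : ℝ))
        * (1 + 2 / (γ - 1) + 2 * C * Real.log γ)
      - 2 * C * ((a x y - a y x) * (h x - h y))
      + (if x = o then a x y + a y x + 2 * C * ((a x y - a y x) * (h x - h y)) else 0)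
      + (if y = o then a x y + a y x + 2 * C * ((a x y - a y x) * (h x - h y)) else 0)
      - (if x = o then if y = o then a x y + a y x else 0 else 0) ≤ a x y + a y x := by
    intro x y
    rcases hedge x y with h0 | ⟨hc, h1, h2, h3⟩
    · simp [h0.1, h0.2]
    have hxy := hℓc x y hc
    have hyx := hℓc y x (by rwa [N.c_symm])
    by_cases hx : x = o
    · by_cases hy : y = o
      · subst hx; subst hy; simp
      · have hx0 : ℓ x = 0 := (hℓo x).2 hx
        rw [show ℓ y - 1 = 0 by omega, show ℓ x - 1 = 0 by omega, if_pos hx, if_neg hy, if_pos hx,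
          if_neg hy]
        simp
    by_cases hy : y = o
    · have hy0 : ℓ y = 0 := (hℓo y).2 hy
      rw [show ℓ y - 1 = 0 by omega, show ℓ x - 1 = 0 by omega, if_neg hx, if_pos hy, if_neg hx]
      simp
    have hx0 : ℓ x ≠ 0 := fun h => hx ((hℓo x).1 h)
    have hy0 : ℓ y ≠ 0 := fun h => hy ((hℓo y).1 h)
    simp only [if_neg hx, if_neg hy, add_zero, sub_zero]
    rcases lt_trichotomy (ℓ x) (ℓ y) with hlt | heq | hgt
    · have e : ((ℓ y - 1 : ℕ) : ℝ) - ((ℓ x - 1 : ℕ) : ℝ) = 1 := by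
        have : ℓ y - 1 = (ℓ x - 1) + 1 := by omega
        rw [this]; push_cast; ring
      have := htang γ hγ x y
      rw [e]
      have e' : 2 / (γ - 1) = 2 * (1 / (γ - 1)) := by ring
      rw [e']
      rw [div_eq_mul_one_div] at this
      linarith
    · rw [heq, sub_self]
      have : 0 ≤ (a x y - a y x) * (h x - h y) := by
        rw [h3]
        rcases le_total (a x y) (a y x) with hle | hle
        · exact mul_nonneg_of_nonpos_of_nonpos (by linarith)
            (by linarith [Real.log_le_log h1 hle])
        · exact mul_nonneg (by linarith) (by linarith [Real.log_le_log h2 hle])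
      have := mul_nonneg hC0.le this
      linarith
    · have e : ((ℓ y - 1 : ℕ) : ℝ) - ((ℓ x - 1 : ℕ) : ℝ) = -1 := by
        have : ℓ x - 1 = (ℓ y - 1) + 1 := by omega
        rw [this]; push_cast; ring
      have := htang γ hγ y x
      rw [e]
      have e' : 2 / (γ - 1) = 2 * (1 / (γ - 1)) := by ring
      rw [e']
      rw [div_eq_mul_one_div] at this
      linarith
  have hsum := Finset.sum_le_sum fun x (_ : x ∈ Finset.univ) =>
    Finset.sum_le_sum fun y (_ : y ∈ Finset.univ) => hpair x y
  simp only [Finset.sum_add_distrib, Finset.sum_sub_distrib] at hsum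
  have s1 : ∑ x, ∑ y, (a x y - a y x) * (((ℓ y - 1 : ℕ) : ℝ) - ((ℓ x - 1 : ℕ) : ℝ))
        * (1 + 2 / (γ - 1) + 2 * C * Real.log γ)
      = 2 * (n - 1) * (1 + 2 / (γ - 1) + 2 * C * Real.log γ) := by
    rw [← hlevel]; simp only [Finset.sum_mul]
  have s2 : ∑ x, ∑ y, 2 * C * ((a x y - a y x) * (h x - h y)) = 2 * C * (2 * H) := by
    rw [← hparts h]; simp only [Finset.mul_sum]
  have s3 : ∑ x, ∑ y, (if x = o then a x y + a y x + 2 * C * ((a x y - a y x) * (h x - h y))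
      else 0) = 1 + 2 * δ + 2 * C * τ := by
    rw [Finset.sum_comm]
    simp only [Finset.sum_ite_eq', Finset.mem_univ, if_true, Finset.sum_add_distrib, hout, ← hδ,
      ← Finset.mul_sum, ← hτ]
    ring
  have s4 : ∑ x, ∑ y, (if y = o then a x y + a y x + 2 * C * ((a x y - a y x) * (h x - h y))
      else 0) = 1 + 2 * δ + 2 * C * τ := by
    rw [← s3, Finset.sum_comm]
    exact Finset.sum_congr rfl fun x _ => Finset.sum_congr rfl fun y _ => by split_ifs <;> ring
  have s5 : ∑ x, ∑ y, (if x = o then if y = o then a x y + a y x else 0 else 0) = 2 * a o o := by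
    rw [Finset.sum_comm]
    simp only [Finset.sum_ite_eq', Finset.mem_univ, if_true]
    ring
  have s6 : ∑ x, ∑ y, a y x = ∑ x, ∑ y, a x y := Finset.sum_comm
  rw [s1, s2, s3, s4, s5, s6] at hsum
  have hloop : a o o ≤ δ := Finset.single_le_sum (f := fun y => a y o) (fun y _ => ha0 y o)
    (Finset.mem_univ o)
  have hδlog := Real.log_le_sub_one_of_pos (x := δ / (2 * C)) (by positivity)
  rw [Real.log_div (by positivity) (by positivity)] at hδlog
  have hδlog' := mul_le_mul_of_nonneg_left hδlog (show 0 ≤ 2 * C by positivity)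
  have e1 : 2 * C * (δ / (2 * C) - 1) = δ - 2 * C := by field_simp
  rw [e1] at hδlog'
  have hCγ : 1 / (γ - 1) ≤ C := by
    rw [hC, div_le_div_iff₀ hγ1 (by positivity)]
    nlinarith
  have e2 : (γ + 1) / (γ - 1) = 1 + 2 * (1 / (γ - 1)) := by field_simp; ring
  have e3 : 2 / (γ - 1) = 2 * (1 / (γ - 1)) := by ring
  rw [htotal, e2]
  rw [e3] at hsum
  have hτ' := mul_le_mul_of_nonneg_left hτ_lower (show 0 ≤ 2 * C by positivity)
  have hH' := mul_le_mul_of_nonneg_left hH_upper (show 0 ≤ 2 * C by positivity)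
  have hlogX' : 2 * C * Real.log (2 * C) + 2 * C * Real.log X = 2 * C * ((n - 1) * Real.log γ) := by
    rw [← mul_add, hlogX]
  linarith

section Comparison

variable {o : D} {ℓ : D → ℕ} {n : ℕ} {g r : ℝ}

/-- Logarithmic derivative of the hitting time generating function, compared with the biased
walk. -/
theorem exists_hasDerivAt_hitGen (hn : 1 ≤ n) (hg : 1 < g) (hs : 0 < s) (hs1 : s < 1)
    (hr : 0 < r) (hr1 : r < 1) (hℓc : ∀ x y, 0 < N.c x y → ℓ x ≤ ℓ y + 1)
    (hℓo : ∀ x, ℓ x = 0 ↔ x = o) (hℓq : ∀ x, 0 < N.q x → ℓ x = n)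
    (hq : 2 * (∑ x, N.q x) * g ^ 2 ≤ (g - 1) ^ 2 * g ^ n * N.m o)
    (hfo : s * r ^ n ≤ N.hitGen s o) :
    ∃ E, HasDerivAt (fun t => N.hitGen t o) (N.hitGen s o / s * E) s ∧
      1 + n * ((g + r ^ 2) / (g - r ^ 2)) ≤ E := by
  have hf0 : 0 < N.hitGen s o := lt_of_lt_of_le (by positivity) hfo
  have hmo := N.m_pos o
  have hr2 : r ^ 2 < 1 := pow_lt_one₀ hr.le hr1 two_ne_zero
  have hgr : 0 < g - r ^ 2 := by linarith
  obtain ⟨u, hu⟩ := N.exists_isPotential hs hs1 (Pi.single o 1)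
  have hu' : N.IsPotential s (Pi.single o (s / N.hitGen s o))
      (fun x => s / N.hitGen s o * u x) := fun x => by
    have h1 : ∑ y, N.c x y * (s / N.hitGen s o * u y)
        = s / N.hitGen s o * ∑ y, N.c x y * u y := by
      rw [Finset.mul_sum]
      exact Finset.sum_congr rfl fun y _ => by ring
    have h2 : Pi.single (M := fun _ => ℝ) o (s / N.hitGen s o) x
        = s / N.hitGen s o * Pi.single (M := fun _ => ℝ) o 1 x := by
      simp [Pi.single_apply]
    rw [h1, h2]
    linear_combination (s / N.hitGen s o) * hu x
  refine ⟨∑ x, N.m x * (s / N.hitGen s o * u x) * (N.hitGen s x / s), ?_, ?_⟩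
  · convert hasDerivAt_hitGen hs hs1 hu using 1
    rw [Finset.mul_sum]
    exact Finset.sum_congr rfl fun x _ => by field_simp
  · have hγ : 1 < g / r ^ 2 := by rw [lt_div_iff₀ (by positivity)]; linarith
    have hγ' : (g / r ^ 2 + 1) / (g / r ^ 2 - 1) = (g + r ^ 2) / (g - r ^ 2) := by
      have : g / r ^ 2 - 1 ≠ 0 := (sub_pos.2 hγ).ne'
      field_simp
    rw [← hγ']
    refine tilted_time_lower_bound hs hs1 hn hγ (N.hitGen_isPotential hs hs1) hf0 hu' hℓc hℓo hℓq
      rfl ?_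
    have h1 : (g / r ^ 2 - 1) ^ 2 * (g / r ^ 2) ^ n / (2 * (g / r ^ 2) ^ 2)
        = (g - r ^ 2) ^ 2 * g ^ n / (2 * g ^ 2 * (r ^ n) ^ 2) := by
      rw [div_pow g, ← pow_mul, mul_comm 2 n, pow_mul]
      field_simp
    rw [h1]
    have h2 : (g - 1) ^ 2 ≤ (g - r ^ 2) ^ 2 := pow_le_pow_left₀ (by linarith) (by linarith) 2
    have h3 : ∑ x, N.q x ≤ (g - r ^ 2) ^ 2 * g ^ n * N.m o / (2 * g ^ 2) := by
      rw [le_div_iff₀ (by positivity)]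
      calc _ = 2 * (∑ x, N.q x) * g ^ 2 := by ring
        _ ≤ _ := hq
        _ ≤ _ := by gcongr
    calc s ^ 2 * ∑ x, N.q x ≤ s ^ 2 * ((g - r ^ 2) ^ 2 * g ^ n * N.m o / (2 * g ^ 2)) := by gcongr
      _ = (g - r ^ 2) ^ 2 * g ^ n / (2 * g ^ 2 * (r ^ n) ^ 2) * (N.m o * (s * r ^ n) ^ 2) := by
          field_simp
      _ ≤ _ := by gcongr

/-- The hitting time generating function is at most that of `1` plus the time at which the biased
walk moves up by `n`. -/
theorem hitGen_biasedDiscount_le (hn : 1 ≤ n) (hg : 1 < g)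
    (hr : 0 < r) (hr1 : r < 1) (hℓc : ∀ x y, 0 < N.c x y → ℓ x ≤ ℓ y + 1)
    (hℓo : ∀ x, ℓ x = 0 ↔ x = o) (hℓq : ∀ x, 0 < N.q x → ℓ x = n)
    (hq : 2 * (∑ x, N.q x) * g ^ 2 ≤ (g - 1) ^ 2 * g ^ n * N.m o) :
    N.hitGen (biasedDiscount g r) o ≤ biasedDiscount g r * r ^ n := by
  set A : ℝ → ℝ := fun t => N.hitGen (biasedDiscount g t) o / (biasedDiscount g t * t ^ n) with hA
  have hden : ∀ t, 0 < t → 0 < biasedDiscount g t * t ^ n := fun t ht =>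
    mul_pos (biasedDiscount_pos hg ht) (pow_pos ht n)
  have hdden : ∀ t, 0 < t → HasDerivAt (fun t => biasedDiscount g t * t ^ n)
      (biasedDiscount g t * t ^ n * ((g - t ^ 2) / (t * (g + t ^ 2)) + n / t)) t := by
    intro t ht
    refine ((hasDerivAt_biasedDiscount hg ht).mul (hasDerivAt_pow n t)).congr_deriv ?_
    have : t ^ n = t ^ (n - 1) * t := by rw [← pow_succ, Nat.sub_add_cancel hn]
    rw [this]
    field_simp
  have hAdiff : ∀ t, 0 < t → t < 1 → DifferentiableAt ℝ A t := by
    intro t ht ht1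
    obtain ⟨u, hu⟩ := N.exists_isPotential (biasedDiscount_pos hg ht)
      (biasedDiscount_lt_one hg ht ht1) (Pi.single o 1)
    exact (((hasDerivAt_hitGen (biasedDiscount_pos hg ht) (biasedDiscount_lt_one hg ht ht1)
      hu).comp t (hasDerivAt_biasedDiscount hg ht)).differentiableAt).div
      (hdden t ht).differentiableAt (hden t ht).ne'
  have hAderiv : ∀ t, 0 < t → t < 1 → 1 ≤ A t → 0 ≤ deriv A t := by
    intro t ht ht1 hAt
    have hs := biasedDiscount_pos hg ht
    rw [hA, le_div_iff₀ (hden t ht), one_mul] at hAt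
    obtain ⟨E, hE, hEle⟩ := exists_hasDerivAt_hitGen hn hg hs
      (biasedDiscount_lt_one hg ht ht1) ht ht1 hℓc hℓo hℓq hq hAt
    have hd := (hE.comp t (hasDerivAt_biasedDiscount hg ht)).div (hdden t ht) (hden t ht).ne'
    have ht2 : t ^ 2 < 1 := pow_lt_one₀ ht.le ht1 two_ne_zero
    have hgt : 0 < g - t ^ 2 := by linarith
    have hval := hd.deriv
    have hfun : A = (fun t => N.hitGen t o) ∘ biasedDiscount g /
      fun t => biasedDiscount g t * t ^ n := rfl
    rw [hfun, hval, Function.comp_apply]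
    refine div_nonneg ?_ (sq_nonneg _)
    have hkey : (g - t ^ 2) / (t * (g + t ^ 2)) + n / t
        ≤ E * ((g - t ^ 2) / (t * (g + t ^ 2))) := by
      calc (g - t ^ 2) / (t * (g + t ^ 2)) + n / t
          = (1 + n * ((g + t ^ 2) / (g - t ^ 2))) * ((g - t ^ 2) / (t * (g + t ^ 2))) := by
            field_simp
        _ ≤ _ := by gcongr
    have hf0 : 0 ≤ N.hitGen (biasedDiscount g t) o := (hden t ht).le.trans hAt
    have := mul_le_mul_of_nonneg_left hkey (mul_nonneg hf0 (hden t ht).le)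
    have e : N.hitGen (biasedDiscount g t) o / biasedDiscount g t * E *
        (biasedDiscount g t * ((g - t ^ 2) / (t * (g + t ^ 2)))) * (biasedDiscount g t * t ^ n)
        = N.hitGen (biasedDiscount g t) o * (biasedDiscount g t * t ^ n) *
          (E * ((g - t ^ 2) / (t * (g + t ^ 2)))) := by
      rw [div_mul_eq_mul_div, div_mul_eq_mul_div, div_mul_eq_mul_div, div_eq_iff hs.ne']
      ring
    linarith
  by_contra! hlt
  have hA1 : 1 < A r := by rw [hA, lt_div_iff₀ (hden r hr), one_mul]; exact hlt
  set ε : ℝ := (A r - 1) / 2 with hε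
  have hε0 : 0 < ε := by rw [hε]; linarith
  have hbound : ∀ t ∈ Set.Ioo r 1, (1 + ε) * t ^ n ≤ 1 := by
    intro t ht
    have ht0 : 0 < t := hr.trans ht.1
    have hmono := image_le_of_deriv_right_lt_deriv_boundary' (f := fun x => -A x)
      (f' := fun x => -deriv A x) (a := r) (b := t) (B := fun x => -A r + ε * (x - r))
      (B' := fun _ => ε)
      (fun x hx => (hAdiff x (hr.trans_le hx.1)
        (hx.2.trans_lt ht.2)).neg.continuousAt.continuousWithinAt)
      (fun x hx => (hAdiff x (hr.trans_le hx.1)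
        (hx.2.trans ht.2)).hasDerivAt.neg.hasDerivWithinAt)
      (by simp) (by fun_prop)
      (fun x _ => by
        have : HasDerivAt (fun x => -A r + ε * (x - r)) ε x := by
          simpa using (((hasDerivAt_id x).sub_const r).const_mul ε).const_add (-A r)
        exact this.hasDerivWithinAt)
      (fun x hx hEq => by
        have hx0 := hr.trans_le hx.1
        have hx1 := hx.2.trans ht.2
        have : 1 ≤ A x := by
          have : ε * (x - r) ≤ ε * 1 := mul_le_mul_of_nonneg_left (by linarith) hε0.le
          linarith
        have := hAderiv x hx0 hx1 this
        linarith)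
      (Set.right_mem_Icc.2 ht.1.le)
    have h1 : ε * (t - r) ≤ ε * 1 := mul_le_mul_of_nonneg_left (by linarith [ht.2]) hε0.le
    have h2 : 1 + ε ≤ A t := by linarith
    have hs := biasedDiscount_pos hg ht0
    rw [hA, le_div_iff₀ (hden t ht0)] at h2
    have h3 := N.hitGen_le hs (biasedDiscount_lt_one hg ht0 ht.2) o
    refine le_of_mul_le_mul_left ?_ hs
    linarith
  have hlim : Tendsto (fun t : ℝ => (1 + ε) * t ^ n) (𝓝[<] 1) (𝓝 (1 + ε)) := by
    have : Continuous fun t : ℝ => (1 + ε) * t ^ n := by fun_prop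
    simpa using (this.tendsto 1).mono_left nhdsWithin_le_nhds
  have := le_of_tendsto hlim (by
    filter_upwards [Ioo_mem_nhdsLT hr1] with t ht using hbound t ht)
  linarith

end Comparison

end KilledNetwork

/-- Product of the kernel `K` along the steps of a path. -/
noncomputable def pathWeight (K : V → V → ℝ≥0∞) {k : ℕ} (y : Fin (k + 1) → V) : ℝ≥0∞ :=
  ∏ i : Fin k, K (y i.castSucc) (y i.succ)

/-- Total weight of the `k`-step paths from `x` that visit `z`. -/
noncomputable def hitWeight (K : V → V → ℝ≥0∞) (z : Set V) (k : ℕ) (x : V) : ℝ≥0∞ :=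
  ∑' y : Fin k → V, if ∃ i, (Fin.cons x y : Fin (k + 1) → V) i ∈ z then
    pathWeight K (Fin.cons x y : Fin (k + 1) → V) else 0

theorem pathWeight_cons_cons (K : V → V → ℝ≥0∞) (x b : V) {k : ℕ} (y : Fin k → V) :
    pathWeight K (Fin.cons x (Fin.cons b y : Fin (k + 1) → V) : Fin (k + 2) → V) =
      K x b * pathWeight K (Fin.cons b y : Fin (k + 1) → V) := by
  unfold pathWeight
  rw [Fin.prod_univ_succ]
  simp

theorem tsum_fin_succ {k : ℕ} (f : (Fin (k + 1) → V) → ℝ≥0∞) :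
    ∑' y, f y = ∑' b, ∑' y : Fin k → V, f (Fin.cons b y) := by
  rw [← ENNReal.tsum_prod, ← (Fin.consEquiv fun _ : Fin (k + 1) => V).tsum_eq]
  rfl

theorem tsum_pathWeight_le_one {K : V → V → ℝ≥0∞} (hK : ∀ x, ∑' y, K x y ≤ 1) (k : ℕ) (x : V) :
    ∑' y : Fin k → V, pathWeight K (Fin.cons x y : Fin (k + 1) → V) ≤ 1 := by
  induction k generalizing x with
  | zero => simp [pathWeight]
  | succ k ih =>
    rw [tsum_fin_succ]
    simp_rw [pathWeight_cons_cons, ENNReal.tsum_mul_left]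
    exact (ENNReal.tsum_le_tsum fun b => mul_le_of_le_one_right' (ih b)).trans (hK x)

theorem hitWeight_le {K : V → V → ℝ≥0∞} {z : Set V} {φ : V → ℝ≥0∞} {C : ℝ≥0∞}
    (hK : ∀ x, ∑' y, K x y ≤ 1) (hC : 1 ≤ C) (hφz : ∀ x ∈ z, 1 ≤ φ x)
    (hφ : ∀ x ∉ z, ∑' y, K x y * φ y ≤ C * φ x) (k : ℕ) (x : V) :
    hitWeight K z k x ≤ C ^ k * φ x := by
  induction k generalizing x with
  | zero =>
    by_cases hx : x ∈ z
    · simp [hitWeight, pathWeight, hx, hφz]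
    · simp [hitWeight, hx]
  | succ k ih =>
    by_cases hx : x ∈ z
    · calc hitWeight K z (k + 1) x
          ≤ ∑' y : Fin (k + 1) → V, pathWeight K (Fin.cons x y : Fin (k + 2) → V) :=
            ENNReal.tsum_le_tsum fun y => by split_ifs <;> simp
        _ ≤ 1 * 1 := by simpa using tsum_pathWeight_le_one hK (k + 1) x
        _ ≤ _ := mul_le_mul' (one_le_pow₀ hC) (hφz x hx)
    · calc hitWeight K z (k + 1) x = ∑' b, K x b * hitWeight K z k b := by
            unfold hitWeight
            rw [tsum_fin_succ]
            refine tsum_congr fun b => ?_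
            rw [← ENNReal.tsum_mul_left]
            refine tsum_congr fun y => ?_
            rw [pathWeight_cons_cons, mul_ite, mul_zero]
            refine if_congr ?_ rfl rfl
            simp [Fin.exists_fin_succ (n := k + 1), hx]
        _ ≤ ∑' b, C ^ k * (K x b * φ b) :=
            ENNReal.tsum_le_tsum fun b => (mul_le_mul_right (ih b) _).trans_eq (by ring)
        _ ≤ C ^ k * (C * φ x) := by
            rw [ENNReal.tsum_mul_left]
            exact mul_le_mul_right (hφ x hx) _
        _ = _ := by ring

/-- The restriction of a kernel to a finite set of vertices. -/
noncomputable def truncate (K : V → V → ℝ≥0∞) (S : Finset V) (x y : V) : ℝ≥0∞ :=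
  if x ∈ S ∧ y ∈ S then K x y else 0

theorem hitWeight_le_of_truncate {K : V → V → ℝ≥0∞} {z : Set V} {k : ℕ} {x : V} {B : ℝ≥0∞}
    (h : ∀ S : Finset V, x ∈ S → hitWeight (truncate K S) z k x ≤ B) : hitWeight K z k x ≤ B := by
  unfold hitWeight
  rw [ENNReal.tsum_eq_iSup_sum]
  refine iSup_le fun P => ?_
  set S : Finset V := insert x (P.biUnion fun y => Finset.univ.image y) with hS
  have hmem : ∀ y ∈ P, ∀ i, (Fin.cons x y : Fin (k + 1) → V) i ∈ S := fun y hy i => by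
    refine Fin.cases (by simp [hS]) (fun j => ?_) i
    simp only [Fin.cons_succ, hS, Finset.mem_insert, Finset.mem_biUnion]
    exact Or.inr ⟨y, hy, by simp⟩
  refine le_trans ?_ (h S (by simp [hS]))
  refine le_trans (Finset.sum_le_sum fun y hy => ?_) (ENNReal.sum_le_tsum P)
  refine le_of_eq (if_congr Iff.rfl (Finset.prod_congr rfl fun i _ => ?_) rfl)
  rw [truncate, if_pos ⟨hmem y hy _, hmem y hy _⟩]

theorem exists_mem_of_hitTime_le {z : Set V} {ω : ℕ → V} {x : ℝ}
    (h : hitTime z ω ≤ ENNReal.ofReal x) : ∃ k ≤ ⌊x⌋₊, ω k ∈ z := by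
  by_contra! hc
  have h1 : ((⌊x⌋₊ + 1 : ℕ) : ℝ≥0∞) ≤ hitTime z ω := le_iInf₂ fun k hk => by
    have : ⌊x⌋₊ < k := by
      by_contra! hle
      exact hc k hle hk
    exact_mod_cast this
  have h2 := h1.trans h
  rw [← ENNReal.ofReal_natCast] at h2
  have h3 : x < ((⌊x⌋₊ + 1 : ℕ) : ℝ) := by exact_mod_cast Nat.lt_floor_add_one x
  have h4 : (0 : ℝ) < ((⌊x⌋₊ + 1 : ℕ) : ℝ) := by positivity
  exact absurd h2 (not_le.2 ((ENNReal.ofReal_lt_ofReal_iff h4).2 h3))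

theorem IsRandomWalk.measure_hitTime_le [Countable V] [MeasurableSpace V] {G : WeightedGraph V}
    {o : V} {μ : Measure (ℕ → V)} (hμ : IsRandomWalk G o μ) (z : Set V) (x : ℝ) :
    μ {ω | hitTime z ω ≤ ENNReal.ofReal x} ≤ hitWeight G.trans z ⌊x⌋₊ o := by
  set k := ⌊x⌋₊
  let Z : Set (Fin (k + 1) → V) := {y | ∃ i, y i ∈ z}
  have hsub : {ω | hitTime z ω ≤ ENNReal.ofReal x} ⊆
      ⋃ y : Z, {ω : ℕ → V | ∀ i : Fin (k + 1), ω (i : ℕ) = y.1 i} := fun ω hω => by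
    obtain ⟨j, hj, hjz⟩ := exists_mem_of_hitTime_le hω
    exact Set.mem_iUnion.2 ⟨⟨fun i => ω i, ⟨⟨j, Nat.lt_succ_of_le hj⟩, hjz⟩⟩, fun _ => rfl⟩
  calc _ ≤ _ := measure_mono hsub
    _ ≤ _ := measure_iUnion_le _
    _ = ∑' y : Z, (fun y : Fin (k + 1) → V => (if y 0 = o then 1 else 0) * pathWeight G.trans y) y :=
        tsum_congr fun y => hμ.2 k y
    _ = ∑' y : Fin (k + 1) → V, Z.indicator
        (fun y => (if y 0 = o then 1 else 0) * pathWeight G.trans y) y :=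
        tsum_subtype Z fun y => (if y 0 = o then 1 else 0) * pathWeight G.trans y
    _ = ∑' b, if b = o then hitWeight G.trans z k o else 0 := by
        rw [tsum_fin_succ]
        refine tsum_congr fun b => ?_
        split_ifs with hb
        · subst hb
          refine tsum_congr fun y => ?_
          simp [Z, Set.indicator_apply]
        · simp [Set.indicator_apply, hb]
    _ = _ := tsum_ite_eq o _

namespace WeightedGraph

variable (G : WeightedGraph V)

theorem vw_ne_zero (x : V) : G.vw x ≠ 0 := (G.vw_pos x).ne'

theorem vw_ne_top (x : V) : G.vw x ≠ ⊤ := (G.vw_lt_top x).ne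

theorem w_le_vw (x y : V) : G.w x y ≤ G.vw x := ENNReal.le_tsum y

theorem w_ne_top (x y : V) : G.w x y ≠ ⊤ :=
  ((G.w_le_vw x y).trans_lt (G.vw_lt_top x)).ne

theorem sum_toReal_w_le (x : V) (S : Finset V) :
    ∑ y ∈ S, (G.w x y).toReal ≤ (G.vw x).toReal := by
  rw [← ENNReal.toReal_sum fun y _ => G.w_ne_top x y]
  exact ENNReal.toReal_mono (G.vw_ne_top x) (ENNReal.sum_le_tsum S)

theorem tsum_trans_le_one (x : V) : ∑' y, G.trans x y ≤ 1 := by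
  simp_rw [trans, div_eq_mul_inv]
  rw [ENNReal.tsum_mul_right]
  exact ENNReal.mul_inv_le_one _

/-- There is a path of `k` positive-weight steps from `o` to `x`. -/
def Reaches (o x : V) (k : ℕ) : Prop :=
  ∃ p : ℕ → V, p 0 = o ∧ p k = x ∧ ∀ i < k, 0 < G.w (p i) (p (i + 1))

variable {G}

theorem Reaches.succ {o x y : V} {k : ℕ} (h : G.Reaches o x k) (hxy : 0 < G.w x y) :
    G.Reaches o y (k + 1) := by
  obtain ⟨p, h0, hk, hp⟩ := h
  refine ⟨fun i => if i ≤ k then p i else y, by simp [h0], by simp, fun i hi => ?_⟩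
  rcases (Nat.lt_succ_iff.1 hi).lt_or_eq with h | rfl
  · simpa [h.le, Nat.succ_le_of_lt h] using hp i h
  · simpa [hk] using hxy

variable (G) in
/-- The distance from `o`, capped at `n`. -/
noncomputable def level (o : V) (n : ℕ) (x : V) : ℕ := sInf {k | k = n ∨ G.Reaches o x k}

theorem level_eq_or_reaches (o : V) (n : ℕ) (x : V) :
    G.level o n x = n ∨ G.Reaches o x (G.level o n x) :=
  Nat.sInf_mem (s := {k | k = n ∨ G.Reaches o x k}) ⟨n, Or.inl rfl⟩

theorem level_le (o : V) (n : ℕ) (x : V) : G.level o n x ≤ n := Nat.sInf_le (Or.inl rfl)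

theorem level_le_of_reaches {o x : V} {k : ℕ} (n : ℕ) (h : G.Reaches o x k) :
    G.level o n x ≤ k := Nat.sInf_le (Or.inr h)

theorem level_eq_zero_iff {o x : V} {n : ℕ} (hn : 1 ≤ n) : G.level o n x = 0 ↔ x = o := by
  refine ⟨fun h => ?_, ?_⟩
  · rcases G.level_eq_or_reaches o n x with h' | ⟨p, h0, hk, -⟩
    · omega
    · rw [h] at hk
      exact hk.symm.trans h0
  · rintro rfl
    exact Nat.le_zero.1 (level_le_of_reaches n ⟨fun _ => x, rfl, rfl, by simp⟩)

theorem level_le_add_one {o x y : V} (n : ℕ) (h : 0 < G.w x y) :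
    G.level o n y ≤ G.level o n x + 1 := by
  rcases G.level_eq_or_reaches o n x with h' | h'
  · rw [h']
    exact (level_le o n y).trans n.le_succ
  · exact level_le_of_reaches n (h'.succ h)

theorem distGE.level_eq {o x y : V} {z : Set V} {n : ℕ} (hdist : G.distGE o z (n + 1))
    (hy : y ∈ z) (h : 0 < G.w x y) : G.level o n x = n := by
  rcases G.level_eq_or_reaches o n x with h' | h'
  · exact h'
  · obtain ⟨p, h0, hk, hp⟩ := h'.succ h
    have := hdist _ p h0 hp (hk ▸ hy)
    exact le_antisymm (level_le o n x) (by omega)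

variable (G) in
/-- The walk on `G` killed on leaving the finite set `S` and absorbed in `z`. -/
noncomputable def killedNetwork (z : Set V) (S : Finset V) :
    KilledNetwork (S.filter (· ∉ z)) where
  c x y := (G.w x y).toReal
  q x := ∑ y ∈ S.filter (· ∈ z), (G.w x y).toReal
  m x := (G.vw x).toReal
  c_symm x y := by rw [G.symm]
  c_nonneg _ _ := ENNReal.toReal_nonneg
  q_nonneg _ := Finset.sum_nonneg fun _ _ => ENNReal.toReal_nonneg
  m_pos x := ENNReal.toReal_pos (G.vw_ne_zero x) (G.vw_ne_top x)
  sum_le x := by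
    rw [Finset.sum_coe_sort (S.filter (· ∉ z)) fun y => (G.w x y).toReal, add_comm,
      Finset.sum_filter_add_sum_filter_not]
    exact G.sum_toReal_w_le x S

theorem sum_q_killedNetwork_le (z : Set V) (S : Finset V) (hz : G.setWeight z ≠ ⊤) :
    ∑ x, (G.killedNetwork z S).q x ≤ (G.setWeight z).toReal := by
  calc ∑ x, (G.killedNetwork z S).q x
      = ∑ x ∈ S.filter (· ∉ z), ∑ y ∈ S.filter (· ∈ z), (G.w y x).toReal := by
        rw [← Finset.sum_coe_sort (S.filter (· ∉ z))]
        simp_rw [G.symm _ (Subtype.val _)]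
        rfl
    _ = ∑ y ∈ S.filter (· ∈ z), ∑ x ∈ S.filter (· ∉ z), (G.w y x).toReal := Finset.sum_comm
    _ ≤ ∑ y ∈ S.filter (· ∈ z), (G.vw y).toReal :=
        Finset.sum_le_sum fun y _ => G.sum_toReal_w_le y _
    _ = (∑ y ∈ S.filter (· ∈ z), G.vw y).toReal :=
        (ENNReal.toReal_sum fun y _ => G.vw_ne_top y).symm
    _ ≤ (G.setWeight z).toReal := by
        refine ENNReal.toReal_mono hz ?_
        rw [setWeight, tsum_subtype]
        refine le_trans (Finset.sum_le_sum fun y hy => ?_)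
          (ENNReal.sum_le_tsum (S.filter (· ∈ z)))
        rw [Set.indicator_of_mem (Finset.mem_filter.1 hy).2]

end WeightedGraph

theorem hitWeight_truncate_le {G : WeightedGraph V} {z : Set V} {S : Finset V} {s : ℝ}
    (hs : 0 < s) (hs1 : s < 1) (k : ℕ) (x : S.filter (· ∉ z)) :
    hitWeight (truncate G.trans S) z k x ≤
      ENNReal.ofReal (s⁻¹ ^ k * (G.killedNetwork z S).hitGen s x) := by
  set N := G.killedNetwork z S
  let F : V → ℝ := fun v =>
    if v ∈ z then 1 else if h : v ∈ S.filter (· ∉ z) then N.hitGen s ⟨v, h⟩ else 0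
  have hFz : ∀ v ∈ z, F v = 1 := fun v hv => if_pos hv
  have hFD : ∀ v : S.filter (· ∉ z), F v = N.hitGen s v := fun v => by
    simp only [F, if_neg (Finset.mem_filter.1 v.2).2, dif_pos v.2, Subtype.coe_eta]
  have hF0 : ∀ v, 0 ≤ F v := fun v => by
    simp only [F]
    split_ifs
    exacts [zero_le_one, N.hitGen_nonneg hs hs1 _, le_rfl]
  have hsinv : 1 ≤ s⁻¹ := (one_le_inv₀ hs).2 hs1.le
  have hle : ∀ u v, truncate G.trans S u v ≤ G.trans u v := fun u v => by
    unfold truncate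
    split_ifs <;> simp
  have main : ∀ u ∉ z, ∑' y, truncate G.trans S u y * ENNReal.ofReal (F y)
      ≤ ENNReal.ofReal s⁻¹ * ENNReal.ofReal (F u) := by
    intro u hu
    by_cases huS : u ∈ S
    swap
    · simp [truncate, huS]
    have hu' : u ∈ S.filter (· ∉ z) := Finset.mem_filter.2 ⟨huS, hu⟩
    have hm := N.m_pos ⟨u, hu'⟩
    rw [tsum_eq_sum (s := S) fun y hy => by simp [truncate, hy]]
    have h1 : ∀ y ∈ S, truncate G.trans S u y * ENNReal.ofReal (F y)
        = ENNReal.ofReal ((G.w u y).toReal * F y / (G.vw u).toReal) := fun y hy => by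
      rw [truncate, if_pos ⟨huS, hy⟩, WeightedGraph.trans,
        ENNReal.ofReal_div_of_pos (by exact hm), ENNReal.ofReal_mul ENNReal.toReal_nonneg,
        ENNReal.ofReal_toReal (G.w_ne_top u y), ENNReal.ofReal_toReal (G.vw_ne_top u),
        ENNReal.mul_div_right_comm]
    rw [Finset.sum_congr rfl h1, ← ENNReal.ofReal_sum_of_nonneg fun y _ =>
      div_nonneg (mul_nonneg ENNReal.toReal_nonneg (hF0 y)) ENNReal.toReal_nonneg,
      ← ENNReal.ofReal_mul (by positivity), ← Finset.sum_div]
    refine ENNReal.ofReal_le_ofReal (le_of_eq ?_)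
    have hpot := N.hitGen_isPotential hs hs1 ⟨u, hu'⟩
    have h2 : ∑ y ∈ S, (G.w u y).toReal * F y
        = N.q ⟨u, hu'⟩ + ∑ y, N.c ⟨u, hu'⟩ y * N.hitGen s y := by
      rw [← Finset.sum_filter_add_sum_filter_not S (· ∈ z)]
      congr 1
      · exact Finset.sum_congr rfl fun y hy => by
          rw [hFz y (Finset.mem_filter.1 hy).2, mul_one]
      · rw [← Finset.sum_coe_sort]
        exact Finset.sum_congr rfl fun y _ => by rw [hFD y]; rfl
    have hmu : (G.vw u).toReal = N.m ⟨u, hu'⟩ := rfl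
    rw [h2, hFD ⟨u, hu'⟩, hmu, div_eq_iff hm.ne', inv_mul_eq_div, div_mul_eq_mul_div,
      eq_div_iff hs.ne']
    linarith
  refine (hitWeight_le (φ := fun v => ENNReal.ofReal (F v)) (C := ENNReal.ofReal s⁻¹)
    (fun u => (ENNReal.tsum_le_tsum (hle u)).trans (G.tsum_trans_le_one u))
    (by simpa using hsinv) (fun u hu => by simp [hFz u hu]) main k x).trans_eq ?_
  rw [hFD, ENNReal.ofReal_mul (by positivity), ENNReal.ofReal_pow (by positivity)]

theorem hitWeight_trans_le {G : WeightedGraph V} {o : V} {z : Set V} {n : ℕ} {g r : ℝ}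
    (hdist : G.distGE o z (n + 1)) (hn : 1 ≤ n) (hg : 1 < g) (hr : 0 < r) (hr1 : r < 1)
    (hz : G.setWeight z ≠ ⊤)
    (hw : 2 * (G.setWeight z).toReal * g ^ 2 ≤ (g - 1) ^ 2 * g ^ n * (G.vw o).toReal) (k : ℕ) :
    hitWeight G.trans z k o ≤ ENNReal.ofReal
      ((biasedDiscount g r)⁻¹ ^ k * (biasedDiscount g r * r ^ n)) := by
  have hoz : o ∉ z := fun h => by
    have := hdist 0 (fun _ => o) rfl (by simp) h
    omega
  have hs := biasedDiscount_pos hg hr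
  refine hitWeight_le_of_truncate fun S ho => ?_
  let x : S.filter (· ∉ z) := ⟨o, Finset.mem_filter.2 ⟨ho, hoz⟩⟩
  refine (hitWeight_truncate_le hs (biasedDiscount_lt_one hg hr hr1) k x).trans ?_
  gcongr
  have hw_pos : ∀ {u v}, 0 < (G.w u v).toReal → 0 < G.w u v := fun h =>
    (ENNReal.toReal_pos_iff.1 h).1
  refine KilledNetwork.hitGen_biasedDiscount_le (ℓ := fun u : S.filter (· ∉ z) => G.level o n u)
    hn hg hr hr1
    (fun u v h => ?_) (fun u => ?_) (fun u h => ?_) ?_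
  · exact WeightedGraph.level_le_add_one n (G.symm _ _ ▸ hw_pos h)
  · rw [WeightedGraph.level_eq_zero_iff hn, Subtype.ext_iff]
  · obtain ⟨y, hy, hpos⟩ :=
      (Finset.sum_pos_iff_of_nonneg fun _ _ => ENNReal.toReal_nonneg).1 h
    exact hdist.level_eq (Finset.mem_filter.1 hy).2 (hw_pos hpos)
  · refine le_trans ?_ hw
    gcongr
    exact WeightedGraph.sum_q_killedNetwork_le z S hz

/-- The value of `r` optimal for the Chernoff bound at speed `1 / a`. -/
theorem exists_biasedDiscount_rate_eq {g a : ℝ} (hg : 1 < g) (ha : 1 < a)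
    (ha' : a < (g + 1) / (g - 1)) :
    ∃ r, 0 < r ∧ r < 1 ∧ r * biasedDiscount g r ^ (-a) =
      g / (a + 1) * (g / (a ^ 2 - 1)) ^ ((a - 1) / 2) * (2 * a / (g + 1)) ^ a := by
  have hg0 : 0 < g := by linarith
  have ha0 : 0 < a := by linarith
  have ha1 : 0 < a - 1 := by linarith
  set ρ : ℝ := g * (a - 1) / (a + 1) with hρ
  have hρ0 : 0 < ρ := by positivity
  rw [lt_div_iff₀ (by linarith)] at ha'
  have hρ1 : ρ < 1 := by
    rw [hρ, div_lt_one (by positivity)]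
    linarith
  have hr0 : 0 < √ρ := Real.sqrt_pos.2 hρ0
  refine ⟨√ρ, hr0, by rwa [Real.sqrt_lt' one_pos, one_pow], ?_⟩
  have hsinv : (biasedDiscount g √ρ)⁻¹ = 2 * a / (g + 1) * (g / (a + 1)) * (√ρ)⁻¹ := by
    rw [biasedDiscount, Real.sq_sqrt hρ0.le, hρ]
    field_simp
    ring
  have hrr : √ρ * (√ρ)⁻¹ ^ a = (ρ ^ ((a - 1) / 2))⁻¹ := by
    rw [Real.inv_rpow hr0.le, ← Real.rpow_neg hr0.le, Real.sqrt_eq_rpow, ← Real.rpow_mul hρ0.le,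
      ← Real.rpow_add hρ0, ← Real.rpow_neg hρ0.le]
    congr 1
    ring
  have hga : (g / (a + 1)) ^ a
      = g / (a + 1) * ((g / (a + 1)) ^ ((a - 1) / 2) * (g / (a + 1)) ^ ((a - 1) / 2)) := by
    rw [← Real.rpow_add (by positivity), add_halves, Real.rpow_sub_one (by positivity)]
    field_simp
  have hbase : g / (a ^ 2 - 1) = g / (a + 1) * (g / (a + 1)) / ρ := by
    have : a ^ 2 - 1 = (a + 1) * (a - 1) := by ring
    rw [this, hρ]
    field_simp
  rw [Real.rpow_neg (biasedDiscount_pos hg hr0).le, ← Real.inv_rpow (biasedDiscount_pos hg hr0).le,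
    hsinv, Real.mul_rpow (by positivity) (by positivity),
    Real.mul_rpow (by positivity) (by positivity), hga, hbase,
    Real.div_rpow (by positivity) hρ0.le, Real.mul_rpow (by positivity) (by positivity)]
  linear_combination (2 * a / (g + 1)) ^ a * (g / (a + 1) *
    ((g / (a + 1)) ^ ((a - 1) / 2) * (g / (a + 1)) ^ ((a - 1) / 2))) * hrr

theorem inv_pow_floor_mul_le {s a r : ℝ} (hs : 0 < s) (hs1 : s < 1) (ha : 0 < a) (hr : 0 < r)
    (n : ℕ) : s⁻¹ ^ ⌊a * n + 1⌋₊ * (s * r ^ n) ≤ (r * s ^ (-a)) ^ n := by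
  have h1 : s⁻¹ ^ ⌊a * n + 1⌋₊ ≤ s⁻¹ ^ (a * n + 1) := by
    rw [← Real.rpow_natCast]
    exact Real.rpow_le_rpow_of_exponent_le ((one_le_inv₀ hs).2 hs1.le)
      (Nat.floor_le (by positivity))
  have h2 : s⁻¹ ^ (a * n + 1) = (s ^ (-a)) ^ n * s⁻¹ := by
    rw [Real.rpow_add_one (inv_pos.2 hs).ne', Real.rpow_mul (inv_pos.2 hs).le,
      Real.rpow_natCast, Real.inv_rpow hs.le, ← Real.rpow_neg hs.le]
  calc s⁻¹ ^ ⌊a * n + 1⌋₊ * (s * r ^ n) ≤ s⁻¹ ^ (a * n + 1) * (s * r ^ n) := by gcongr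
    _ = _ := by rw [h2, mul_pow]; field_simp

/-- Large deviation upper bound `P(T_{oz} ≤ an+1) ≤ e^{-I_g(a) n}`,
where `e^{-I_g(a)} = (g/(a+1)) (g/(a²-1))^((a-1)/2) (2a/(g+1))^a`. -/
theorem hitting_time_large_deviation_bound
    {V : Type*} [Countable V] [MeasurableSpace V] [MeasurableSingletonClass V]
    (G : WeightedGraph V) (o : V) (z : Set V) (n : ℕ) (g a : ℝ)
    (μ : Measure (ℕ → V)) (hμ : IsRandomWalk G o μ)
    (hdist : G.distGE o z (n + 1))
    (hg : 1 < g)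
    (hsol : ENNReal.ofReal ((g - 1) ^ 2 * g ^ ((n : ℝ) - 2)) = 2 * G.setWeight z / G.vw o)
    (ha : 1 < a) (ha' : a < (g + 1) / (g - 1)) :
    μ {ω | hitTime z ω ≤ ENNReal.ofReal (a * n + 1)}
      ≤ ENNReal.ofReal
          ((g / (a + 1) * (g / (a ^ 2 - 1)) ^ ((a - 1) / 2) * (2 * a / (g + 1)) ^ a) ^ n) := by
  have := hμ.1
  rcases Nat.eq_zero_or_pos n with rfl | hn
  · simpa using prob_le_one
  have hvw0 := G.vw_ne_zero o
  have hvwt := G.vw_ne_top o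
  have hw : ENNReal.ofReal ((g - 1) ^ 2 * g ^ ((n : ℝ) - 2)) * G.vw o = 2 * G.setWeight z := by
    rw [hsol, ENNReal.div_mul_cancel hvw0 hvwt]
  have hz : G.setWeight z ≠ ⊤ := fun h => by
    rw [h, ENNReal.mul_top two_ne_zero] at hw
    exact ENNReal.mul_ne_top ENNReal.ofReal_ne_top hvwt hw
  have hg0 : 0 < g := by linarith
  have hw' := congrArg ENNReal.toReal hw
  rw [ENNReal.toReal_mul, ENNReal.toReal_mul, ENNReal.toReal_ofReal (by positivity),
    Real.rpow_sub hg0, Real.rpow_natCast, Real.rpow_two, ENNReal.toReal_ofNat] at hw'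
  have hw'' : 2 * (G.setWeight z).toReal * g ^ 2 = (g - 1) ^ 2 * g ^ n * (G.vw o).toReal := by
    rw [← hw']
    field_simp
  obtain ⟨r, hr, hr1, hrate⟩ := exists_biasedDiscount_rate_eq hg ha ha'
  rw [← hrate]
  calc _ ≤ _ := hμ.measure_hitTime_le z _
    _ ≤ _ := hitWeight_trans_le hdist hn hg hr hr1 hz hw''.le _
    _ ≤ _ := ENNReal.ofReal_le_ofReal (inv_pow_floor_mul_le (biasedDiscount_pos hg hr)
      (biasedDiscount_lt_one hg hr hr1) (by linarith) hr n)

end RWHitting
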